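/- arXiv:1312.3122 — 2 statements merged into one kernel-verified Lean document; each statement's English description precedes it below -/
import Mathlib

section
/- Let f: 𝔻 → ℂ be twice continuously differentiable with Re(conj(f)·Δf) ≥ 0 on 𝔻, and let p ∈ [2,∞). Then for every r ∈ (0,1): ∫_{𝔻_r} |f(z)|^p · log(r/|z|) dσ(z) ≤ (r²/2) · M_p^p(r,f), where dσ denotes the normalized area measure (dσ = dA/π) and 𝔻_r = {z : |z| < r}. -/
open Complex Metric MeasureTheory

/-- The (real) Laplacian Δg = g_xx + g_yy of a function on ℂ. -/
noncomputable def lap {E : Type*} [NormedAddCommGroup E] [NormedSpace ℝ E]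
    (g : ℂ → E) (z : ℂ) : E :=
  fderiv ℝ (fun w => fderiv ℝ g w 1) z 1 +
    fderiv ℝ (fun w => fderiv ℝ g w Complex.I) z Complex.I

theorem hasDerivAt_intervalIntegral_of_continuousOn {F F' : ℝ → ℝ → ℝ} {s : Set ℝ}
    (hs : IsOpen s) (a b : ℝ)
    (hF : ContinuousOn (Function.uncurry F) (s ×ˢ Set.univ))
    (hF' : ContinuousOn (Function.uncurry F') (s ×ˢ Set.univ))
    (hd : ∀ x ∈ s, ∀ t, HasDerivAt (F · t) (F' x t) x) {x₀ : ℝ} (hx₀ : x₀ ∈ s) :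
    HasDerivAt (fun x => ∫ t in a..b, F x t) (∫ t in a..b, F' x₀ t) x₀ := by
  obtain ⟨ε, hε, hsub⟩ := Metric.nhds_basis_closedBall.mem_iff.1 (hs.mem_nhds hx₀)
  have hslice : ∀ {G : ℝ → ℝ → ℝ}, ContinuousOn (Function.uncurry G) (s ×ˢ Set.univ) →
      ∀ x ∈ s, Continuous (G x) := fun {G} hG x hx =>
    hG.comp_continuous (f := fun t => (x, t)) (by fun_prop) (fun t => ⟨hx, trivial⟩)
  obtain ⟨C, hC⟩ := ((isCompact_closedBall x₀ ε).prod (isCompact_uIcc (a := a) (b := b))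
    ).exists_bound_of_continuousOn (hF'.mono (Set.prod_mono hsub (Set.subset_univ _)))
  refine (intervalIntegral.hasDerivAt_integral_of_dominated_loc_of_deriv_le
    (F := F) (F' := F') (bound := fun _ => C) (closedBall_mem_nhds x₀ hε) ?_ ?_ ?_ ?_ ?_ ?_).2
  · filter_upwards [hs.mem_nhds hx₀] with x hx
    exact (hslice hF x hx).aestronglyMeasurable
  · exact (hslice hF x₀ hx₀).intervalIntegrable _ _
  · exact (hslice hF' x₀ hx₀).aestronglyMeasurable
  · exact .of_forall fun t ht x hx => hC (x, t) ⟨hx, Set.uIoc_subset_uIcc ht⟩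
  · exact intervalIntegrable_const
  · exact .of_forall fun t _ x hx => hd x (hsub hx) t

theorem fderiv_fderiv_apply {E : Type*} [NormedAddCommGroup E] [NormedSpace ℝ E]
    {g : ℂ → E} {z : ℂ} (h : DifferentiableAt ℝ (fderiv ℝ g) z) (v w : ℂ) :
    fderiv ℝ (fun y => fderiv ℝ g y v) z w = fderiv ℝ (fderiv ℝ g) z w v := by
  have := (h.hasFDerivAt.clm_apply (hasFDerivAt_const v z)).fderiv
  simp [this]

/-- If `Re(conj(f)·Δf) ≥ 0` at `z`, then `(|f|² + ε)^q` has nonnegative Laplacian at `z`. -/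
theorem lap_normSq_add_rpow_nonneg {f : ℂ → ℂ} (hf : ContDiffOn ℝ 2 f (ball (0:ℂ) 1))
    {z : ℂ} (hz : z ∈ ball (0:ℂ) 1) (hRe : 0 ≤ ((starRingEnd ℂ) (f z) * lap f z).re)
    {q ε : ℝ} (hq : 1 ≤ q) (hε : 0 < ε) :
    0 ≤ lap (fun w => (‖f w‖ ^ 2 + ε) ^ q) z := by
  have hdf : ∀ w ∈ ball (0:ℂ) 1, DifferentiableAt ℝ f w := fun w hw =>
    (hf.differentiableOn (by norm_num)).differentiableAt (isOpen_ball.mem_nhds hw)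
  have hdf' : DifferentiableAt ℝ (fderiv ℝ f) z :=
    ((hf.fderiv_of_isOpen isOpen_ball (m := 1) (by norm_num)).differentiableOn
      (by norm_num)).differentiableAt (isOpen_ball.mem_nhds hz)
  have hpos : ∀ w, 0 < ‖f w‖ ^ 2 + ε := fun w => by positivity
  have hsecond : ∀ v : ℂ,
      2 * q * (‖f z‖ ^ 2 + ε) ^ (q - 1) *
          inner ℝ (f z) (fderiv ℝ (fun w => fderiv ℝ f w v) z v) ≤
        fderiv ℝ (fun w => fderiv ℝ (fun w => (‖f w‖ ^ 2 + ε) ^ q) w v) z v := by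
    intro v
    have h1 : (fun w => fderiv ℝ (fun w => (‖f w‖ ^ 2 + ε) ^ q) w v) =ᶠ[nhds z]
        fun w => (q * (‖f w‖ ^ 2 + ε) ^ (q - 1)) * (2 * inner ℝ (f w) (fderiv ℝ f w v)) := by
      filter_upwards [isOpen_ball.mem_nhds hz] with w hw
      rw [(((hdf w hw).hasFDerivAt.norm_sq.add_const ε).rpow_const
        (p := q) (Or.inl (hpos w).ne')).fderiv]
      simp
      left
      ring
    rw [h1.fderiv_eq]
    have h2 := ((((hdf z hz).hasFDerivAt.norm_sq.add_const ε).rpow_const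
        (p := q - 1) (Or.inl (hpos z).ne')).const_mul q).mul
      (((hdf z hz).hasFDerivAt.inner ℝ
        (hdf'.hasFDerivAt.clm_apply (hasFDerivAt_const v z))).const_mul 2)
    have h3 := h2.fderiv
    simp only [Pi.mul_def] at h3
    rw [h3, fderiv_fderiv_apply hdf']
    have hA : 0 ≤ q * (‖f z‖ ^ 2 + ε) ^ (q - 1) := by have := hpos z; positivity
    have hB : 0 ≤ (‖f z‖ ^ 2 + ε) ^ (q - 1 - 1) := by have := hpos z; positivity
    have hC : 0 ≤ q * (q - 1) := by nlinarith
    simp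
    nlinarith [mul_nonneg (mul_nonneg hC hB) (sq_nonneg
        ((fderiv ℝ f z v).re * (f z).re + (fderiv ℝ f z v).im * (f z).im)),
      mul_nonneg hA (sq_nonneg ‖fderiv ℝ f z v‖)]
  have hA : 0 ≤ 2 * q * (‖f z‖ ^ 2 + ε) ^ (q - 1) := by have := hpos z; positivity
  have hsum := mul_nonneg hA hRe
  have hinner : ((starRingEnd ℂ) (f z) * lap f z).re = inner ℝ (f z) (lap f z) := by
    rw [Complex.inner, mul_comm]
  rw [hinner, lap, inner_add_right] at hsum
  rw [lap]
  linarith [hsecond 1, hsecond I]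

theorem lap_eq_fderiv_fderiv_of_norm_eq_one {u : ℂ → ℝ} {z : ℂ}
    (h : DifferentiableAt ℝ (fderiv ℝ u) z) {e : ℂ} (he : ‖e‖ = 1) :
    lap u z = fderiv ℝ (fderiv ℝ u) z e e + fderiv ℝ (fderiv ℝ u) z (e * I) (e * I) := by
  have h1 : e = e.re • (1 : ℂ) + e.im • I := by apply Complex.ext <;> simp
  have h2 : e * I = (-e.im) • (1 : ℂ) + e.re • I := by apply Complex.ext <;> simp
  have h3 : e.re ^ 2 + e.im ^ 2 = 1 := by
    have := Complex.sq_norm e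
    rw [he, Complex.normSq_apply] at this
    linarith
  have h4 : ∀ (a b : ℝ) (B : ℂ →L[ℝ] ℂ →L[ℝ] ℝ), B (a • (1 : ℂ) + b • I) (a • (1 : ℂ) + b • I) =
      a ^ 2 * B 1 1 + a * b * (B 1 I + B I 1) + b ^ 2 * B I I := by
    intro a b B
    simp only [map_add, map_smul, add_apply, smul_apply, smul_eq_mul]
    ring
  have h5 := h4 e.re e.im (fderiv ℝ (fderiv ℝ u) z)
  rw [← h1] at h5
  rw [lap, fderiv_fderiv_apply h, fderiv_fderiv_apply h, h2, h4, h5]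
  linear_combination (-(fderiv ℝ (fderiv ℝ u) z 1 1) - fderiv ℝ (fderiv ℝ u) z I I) * h3

theorem hasDerivAt_fderiv_comp_apply {u : ℂ → ℝ} {γ δ : ℝ → ℂ} {γ' δ' : ℂ} {t : ℝ}
    (h : DifferentiableAt ℝ (fderiv ℝ u) (γ t)) (hγ : HasDerivAt γ γ' t)
    (hδ : HasDerivAt δ δ' t) :
    HasDerivAt (fun s => fderiv ℝ u (γ s) (δ s))
      (fderiv ℝ (fderiv ℝ u) (γ t) γ' (δ t) + fderiv ℝ u (γ t) δ') t := by
  have h1 : HasDerivAt (fun s => fderiv ℝ u (γ s)) (fderiv ℝ (fderiv ℝ u) (γ t) γ') t :=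
    h.hasFDerivAt.comp_hasDerivAt t hγ
  exact h1.clm_apply hδ

/-- The circle means of a `C²` function with nonnegative Laplacian are nondecreasing. -/
theorem monotoneOn_circle_integral_of_lap_nonneg {u : ℂ → ℝ} (hu : ContDiffOn ℝ 2 u (ball (0:ℂ) 1))
    (hlap : ∀ z ∈ ball (0:ℂ) 1, 0 ≤ lap u z) :
    MonotoneOn (fun ρ : ℝ => ∫ θ in (0:ℝ)..(2 * Real.pi), u (ρ * exp (θ * I)))
      (Set.Ico 0 1) := by
  have hDu := hu.fderiv_of_isOpen isOpen_ball (m := 1) (by norm_num)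
  have hD2u := hDu.fderiv_of_isOpen isOpen_ball (m := 0) (by norm_num)
  have hnorm : ∀ θ : ℝ, ‖exp (θ * I)‖ = 1 := norm_exp_ofReal_mul_I
  have hmem : ∀ ρ ∈ Set.Ioo (-1 : ℝ) 1, ∀ θ : ℝ, (ρ : ℂ) * exp (θ * I) ∈ ball (0:ℂ) 1 := by
    intro ρ hρ θ
    rw [mem_ball_zero_iff, norm_mul, hnorm, mul_one, norm_real, Real.norm_eq_abs, abs_lt]
    exact hρ
  have hdu : ∀ z ∈ ball (0:ℂ) 1, HasFDerivAt u (fderiv ℝ u z) z := fun z hz =>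
    ((hu.differentiableOn (by norm_num)).differentiableAt (isOpen_ball.mem_nhds hz)).hasFDerivAt
  have hdDu : ∀ z ∈ ball (0:ℂ) 1, DifferentiableAt ℝ (fderiv ℝ u) z := fun z hz =>
    (hDu.differentiableOn (by norm_num)).differentiableAt (isOpen_ball.mem_nhds hz)
  have hpath : ∀ ρ θ : ℝ, HasDerivAt (fun ρ : ℝ => (ρ : ℂ) * exp (θ * I)) (exp (θ * I)) ρ := by
    intro ρ θ
    simpa using (Complex.ofRealCLM.hasDerivAt (x := ρ)).mul_const (exp (θ * I))
  have hexp : ∀ θ : ℝ, HasDerivAt (fun θ : ℝ => exp (θ * I)) (exp (θ * I) * I) θ := by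
    intro θ
    simpa using ((Complex.ofRealCLM.hasDerivAt (x := θ)).mul_const I).cexp
  set S : Set (ℝ × ℝ) := Set.Ioo (-1) 1 ×ˢ Set.univ
  have hmaps : Set.MapsTo (fun x : ℝ × ℝ => (x.1 : ℂ) * exp (x.2 * I)) S (ball (0:ℂ) 1) :=
    fun x hx => hmem x.1 hx.1 x.2
  have hc : ContinuousOn (fun x : ℝ × ℝ => (x.1 : ℂ) * exp (x.2 * I)) S := by fun_prop
  have hce : ContinuousOn (fun x : ℝ × ℝ => exp (x.2 * I)) S := by fun_prop
  have hcu : ContinuousOn (fun x : ℝ × ℝ => u (x.1 * exp (x.2 * I))) S :=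
    hu.continuousOn.comp hc hmaps
  have hcD := hDu.continuousOn.comp hc hmaps
  have hcD2 := hD2u.continuousOn.comp hc hmaps
  have hcF' : ContinuousOn (fun x : ℝ × ℝ =>
      fderiv ℝ u (x.1 * exp (x.2 * I)) (exp (x.2 * I))) S := hcD.clm_apply hce
  have hcF'' : ContinuousOn (fun x : ℝ × ℝ => fderiv ℝ (fderiv ℝ u) (x.1 * exp (x.2 * I))
      (exp (x.2 * I)) (exp (x.2 * I))) S := (hcD2.clm_apply hce).clm_apply hce
  have hderiv := fun ρ (hρ : ρ ∈ Set.Ioo (-1 : ℝ) 1) =>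
    hasDerivAt_intervalIntegral_of_continuousOn (F := fun ρ θ : ℝ => u (ρ * exp (θ * I)))
      (F' := fun ρ θ : ℝ => fderiv ℝ u (ρ * exp (θ * I)) (exp (θ * I)))
      isOpen_Ioo 0 (2 * Real.pi) hcu hcF'
      (fun ρ hρ θ => (hdu _ (hmem ρ hρ θ)).comp_hasDerivAt ρ (hpath ρ θ)) hρ
  have hcK' : ContinuousOn (fun x : ℝ × ℝ =>
      fderiv ℝ u (x.1 * exp (x.2 * I)) (exp (x.2 * I)) +
        x.1 * fderiv ℝ (fderiv ℝ u) (x.1 * exp (x.2 * I)) (exp (x.2 * I)) (exp (x.2 * I))) S :=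
    hcF'.add (continuousOn_fst.mul hcF'')
  have hderiv' := fun ρ (hρ : ρ ∈ Set.Ioo (-1 : ℝ) 1) =>
    hasDerivAt_intervalIntegral_of_continuousOn
      (F := fun ρ θ : ℝ => ρ * fderiv ℝ u (ρ * exp (θ * I)) (exp (θ * I)))
      (F' := fun ρ θ : ℝ => fderiv ℝ u (ρ * exp (θ * I)) (exp (θ * I)) +
        ρ * fderiv ℝ (fderiv ℝ u) (ρ * exp (θ * I)) (exp (θ * I)) (exp (θ * I)))
      isOpen_Ioo 0 (2 * Real.pi) (continuousOn_fst.mul hcF') hcK'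
      (fun ρ hρ θ => by
        have := (hasDerivAt_id ρ).mul (hasDerivAt_fderiv_comp_apply (hdDu _ (hmem ρ hρ θ))
          (hpath ρ θ) (hasDerivAt_const ρ (exp (θ * I))))
        refine this.congr_deriv ?_
        simp only [map_zero, add_zero, one_mul, id]) hρ
  have hslice : ∀ {G : ℝ × ℝ → ℝ}, ContinuousOn G S → ∀ ρ ∈ Set.Ioo (-1 : ℝ) 1,
      Continuous fun θ => G (ρ, θ) := fun {G} hG ρ hρ =>
    hG.comp_continuous (f := fun t => (ρ, t)) (by fun_prop) (fun t => ⟨hρ, trivial⟩)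
  have hnonneg : ∀ ρ ∈ Set.Ioo (0 : ℝ) 1, 0 ≤ ∫ θ in (0:ℝ)..(2 * Real.pi),
      (fderiv ℝ u (ρ * exp (θ * I)) (exp (θ * I)) +
        ρ * fderiv ℝ (fderiv ℝ u) (ρ * exp (θ * I)) (exp (θ * I)) (exp (θ * I))) := by
    intro ρ hρ
    have hρ' : ρ ∈ Set.Ioo (-1 : ℝ) 1 := ⟨by linarith [hρ.1], hρ.2⟩
    let L' : ℝ → ℝ := fun θ =>
      fderiv ℝ (fderiv ℝ u) (ρ * exp (θ * I)) (ρ * (exp (θ * I) * I)) (exp (θ * I) * I) -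
        fderiv ℝ u (ρ * exp (θ * I)) (exp (θ * I))
    have hL : ∀ θ : ℝ, HasDerivAt (fun θ : ℝ =>
        fderiv ℝ u (ρ * exp (θ * I)) (exp (θ * I) * I)) (L' θ) θ := by
      intro θ
      refine (hasDerivAt_fderiv_comp_apply (γ := fun θ : ℝ => (ρ : ℂ) * exp (θ * I))
        (hdDu _ (hmem ρ hρ' θ))
        ((hexp θ).const_mul (ρ : ℂ)) ((hexp θ).mul_const I)).congr_deriv ?_
      have : exp (θ * I) * I * I = - exp (θ * I) := by rw [mul_assoc, I_mul_I]; ring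
      rw [this, map_neg, ← sub_eq_add_neg]
    have hcont : Continuous L' := by
      have h1 : ContinuousOn (fun x : ℝ × ℝ => (x.1 : ℂ) * (exp (x.2 * I) * I)) S := by fun_prop
      have h2 : ContinuousOn (fun x : ℝ × ℝ => exp (x.2 * I) * I) S := by fun_prop
      exact hslice (((hcD2.clm_apply h1).clm_apply h2).sub hcF') ρ hρ'
    have hint0 : ∫ θ in (0:ℝ)..(2 * Real.pi), L' θ = 0 := by
      rw [intervalIntegral.integral_eq_sub_of_hasDerivAt (fun θ _ => hL θ)
        (hcont.intervalIntegrable _ _)]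
      simp [exp_two_pi_mul_I]
    have hadd := intervalIntegral.integral_add (μ := volume)
      ((hslice hcK' ρ hρ').intervalIntegrable 0 (2 * Real.pi)) (hcont.intervalIntegrable _ _)
    rw [hint0, add_zero] at hadd
    rw [← hadd]
    refine intervalIntegral.integral_nonneg (by positivity) fun θ _ => ?_
    have h := hlap _ (hmem ρ hρ' θ)
    rw [lap_eq_fderiv_fderiv_of_norm_eq_one (hdDu _ (hmem ρ hρ' θ)) (hnorm θ)] at h
    have hsmul : (ρ : ℂ) * (exp (θ * I) * I) = ρ • (exp (θ * I) * I) := by simp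
    simp only [L', hsmul, map_smul, smul_apply, smul_eq_mul]
    linarith [mul_nonneg hρ.1.le h]
  have hψ : ∀ ρ ∈ Set.Ioo (0 : ℝ) 1, 0 ≤ ∫ θ in (0:ℝ)..(2 * Real.pi),
      ρ * fderiv ℝ u (ρ * exp (θ * I)) (exp (θ * I)) := by
    intro ρ hρ
    have hmono : MonotoneOn (fun ρ : ℝ => ∫ θ in (0:ℝ)..(2 * Real.pi),
        ρ * fderiv ℝ u (ρ * exp (θ * I)) (exp (θ * I))) (Set.Ico 0 1) := by
      refine monotoneOn_of_deriv_nonneg (convex_Ico 0 1)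
        (fun x hx => (hderiv' x ⟨by linarith [hx.1], hx.2⟩).continuousAt.continuousWithinAt)
        ?_ ?_ <;> rw [interior_Ico] <;> intro x hx
      · exact (hderiv' x ⟨by linarith [hx.1], hx.2⟩).differentiableAt.differentiableWithinAt
      · rw [(hderiv' x ⟨by linarith [hx.1], hx.2⟩).deriv]
        exact hnonneg x hx
    simpa using hmono ⟨le_rfl, one_pos⟩ ⟨hρ.1.le, hρ.2⟩ hρ.1.le
  refine monotoneOn_of_deriv_nonneg (convex_Ico 0 1)
    (fun x hx => (hderiv x ⟨by linarith [hx.1], hx.2⟩).continuousAt.continuousWithinAt)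
    ?_ ?_ <;> rw [interior_Ico] <;> intro x hx
  · exact (hderiv x ⟨by linarith [hx.1], hx.2⟩).differentiableAt.differentiableWithinAt
  · rw [(hderiv x ⟨by linarith [hx.1], hx.2⟩).deriv]
    have := hψ x hx
    rw [intervalIntegral.integral_const_mul] at this
    exact nonneg_of_mul_nonneg_right this hx.1

theorem monotoneOn_circle_integral_norm_rpow {f : ℂ → ℂ} (hf : ContDiffOn ℝ 2 f (ball (0:ℂ) 1))
    (hRe : ∀ z ∈ ball (0:ℂ) 1, 0 ≤ ((starRingEnd ℂ) (f z) * lap f z).re)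
    {p : ℝ} (hp : 2 ≤ p) :
    MonotoneOn (fun ρ : ℝ => ∫ θ in (0:ℝ)..(2 * Real.pi), ‖f (ρ * exp (θ * I))‖ ^ p)
      (Set.Ico 0 1) := by
  intro a ha b hb hab
  have hcont : ∀ ρ ∈ Set.Ico (0:ℝ) 1, Continuous fun ε : ℝ =>
      ∫ θ in (0:ℝ)..(2 * Real.pi), (‖f (ρ * exp (θ * I))‖ ^ 2 + ε) ^ (p / 2) := by
    intro ρ hρ
    have hcf : Continuous fun θ : ℝ => f (ρ * exp (θ * I)) :=
      hf.continuousOn.comp_continuous (by fun_prop) fun θ => by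
        simpa [norm_exp_ofReal_mul_I, abs_of_nonneg hρ.1] using hρ.2
    refine intervalIntegral.continuous_parametric_intervalIntegral_of_continuous' ?_ _ _
    refine Continuous.rpow_const ?_ fun _ => Or.inr (by linarith)
    exact ((hcf.comp continuous_snd).norm.pow 2).add continuous_fst
  have hlim : ∀ ρ ∈ Set.Ico (0:ℝ) 1, Filter.Tendsto (fun ε : ℝ =>
      ∫ θ in (0:ℝ)..(2 * Real.pi), (‖f (ρ * exp (θ * I))‖ ^ 2 + ε) ^ (p / 2))
      (nhdsWithin 0 (Set.Ioi 0))
      (nhds (∫ θ in (0:ℝ)..(2 * Real.pi), ‖f (ρ * exp (θ * I))‖ ^ p)) := by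
    intro ρ hρ
    convert ((hcont ρ hρ).tendsto 0).mono_left nhdsWithin_le_nhds using 4 with θ
    rw [add_zero, ← Real.rpow_natCast, ← Real.rpow_mul (norm_nonneg _)]
    congr 1
    push_cast
    ring
  refine le_of_tendsto_of_tendsto (hlim a ha) (hlim b hb) ?_
  filter_upwards [self_mem_nhdsWithin] with ε hε
  have hε : 0 < ε := hε
  refine monotoneOn_circle_integral_of_lap_nonneg (u := fun w => (‖f w‖ ^ 2 + ε) ^ (p / 2)) ?_
    (fun z hz => lap_normSq_add_rpow_nonneg hf hz (hRe z hz) (by linarith) hε) ha hb hab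
  exact ((hf.norm_sq ℝ).add contDiffOn_const).rpow_const_of_ne fun z _ => by positivity

theorem integral_mul_log_div {r : ℝ} (hr : 0 < r) :
    ∫ ρ in (0:ℝ)..r, ρ * Real.log (r / ρ) = r ^ 2 / 4 := by
  have hcont : Continuous fun ρ : ℝ => ρ * Real.log r - ρ * Real.log ρ :=
    (continuous_id.mul continuous_const).sub Real.continuous_mul_log
  have hcongr : ∀ ρ ∈ Set.uIoc 0 r,
      ρ * Real.log (r / ρ) = ρ * Real.log r - ρ * Real.log ρ := by
    intro ρ hρ
    rw [Set.uIoc_of_le hr.le] at hρ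
    rw [Real.log_div hr.ne' hρ.1.ne', mul_sub]
  rw [intervalIntegral.integral_congr_ae (.of_forall hcongr),
    intervalIntegral.integral_eq_sub_of_hasDerivAt_of_le hr.le
      (f := fun ρ => ρ ^ 2 / 2 * Real.log r + ρ ^ 2 / 4 - ρ / 2 * (ρ * Real.log ρ)) ?_ ?_
      (hcont.intervalIntegrable _ _)]
  · simp
    ring
  · have := Real.continuous_mul_log
    fun_prop
  · intro ρ hρ
    have h := ((((hasDerivAt_pow 2 ρ).div_const 2).mul_const (Real.log r)).add
      ((hasDerivAt_pow 2 ρ).div_const 4)).sub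
      (((hasDerivAt_id ρ).div_const 2).mul (Real.hasDerivAt_mul_log hρ.1.ne'))
    refine h.congr_deriv ?_
    norm_num
    ring

theorem setIntegral_ball_eq_polar (G : ℂ → ℝ) (r : ℝ) :
    ∫ z in ball (0:ℂ) r, G z =
      ∫ x in Set.Ioo 0 r ×ˢ Set.Ioo (-Real.pi) Real.pi, x.1 * G (x.1 * exp (x.2 * I)) := by
  have hsymm : ∀ x : ℝ × ℝ, Complex.polarCoord.symm x = x.1 * exp (x.2 * I) := fun x => by
    rw [Complex.polarCoord_symm_apply, exp_mul_I]
    push_cast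
    rfl
  rw [← integral_indicator measurableSet_ball, ← Complex.integral_comp_polarCoord_symm,
    setIntegral_eq_of_subset_of_forall_sdiff_eq_zero
      (s := Set.Ioo 0 r ×ˢ Set.Ioo (-Real.pi) Real.pi)]
  · refine setIntegral_congr_fun (measurableSet_Ioo.prod measurableSet_Ioo) fun x hx => ?_
    have hmem : Complex.polarCoord.symm x ∈ ball (0:ℂ) r := by
      rw [mem_ball_zero_iff, Complex.norm_polarCoord_symm, abs_of_pos hx.1.1]
      exact hx.1.2
    rw [hsymm] at hmem
    simp only [hsymm, Set.indicator_of_mem hmem, smul_eq_mul]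
  · exact polarCoord.open_target.measurableSet
  · exact Set.prod_mono Set.Ioo_subset_Ioi_self subset_rfl
  · rintro x ⟨hx, hx'⟩
    have hmem : Complex.polarCoord.symm x ∉ ball (0:ℂ) r := by
      rw [mem_ball_zero_iff, Complex.norm_polarCoord_symm, abs_of_pos hx.1]
      exact fun h => hx' ⟨⟨hx.1, h⟩, hx.2⟩
    rw [Set.indicator_of_notMem hmem, smul_zero]

/-- If f ∈ C²(𝔻), Re(conj(f)·Δf) ≥ 0 on 𝔻 and p ∈ [2,∞), then for
every r ∈ (0,1): ∫_{𝔻_r} |f(z)|^p log(r/|z|) dσ(z) ≤ (r²/2) M_p^p(r,f), where dσ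
is the normalized area measure dA/π. -/
theorem log_weighted_integral_le (f : ℂ → ℂ)
    (hf : ContDiffOn ℝ 2 f (ball (0:ℂ) 1))
    (hRe : ∀ z ∈ ball (0:ℂ) 1, 0 ≤ ((starRingEnd ℂ) (f z) * lap f z).re)
    (p : ℝ) (hp : 2 ≤ p) :
    ∀ r ∈ Set.Ioo (0:ℝ) 1,
      (1 / Real.pi) * ∫ z in ball (0:ℂ) r, ‖f z‖ ^ p * Real.log (r / ‖z‖) ≤
        (r ^ 2 / 2) *
          ((1 / (2 * Real.pi)) *
            ∫ θ in (0:ℝ)..(2 * Real.pi),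
              ‖f ((r : ℂ) * Complex.exp (θ * Complex.I))‖ ^ p) := by
  intro r hr
  set M : ℝ → ℝ := fun ρ => ∫ θ in (0:ℝ)..(2 * Real.pi), ‖f (ρ * exp (θ * I))‖ ^ p
  have hmono : MonotoneOn M (Set.Ico 0 1) := monotoneOn_circle_integral_norm_rpow hf hRe hp
  have hM' : ∀ ρ : ℝ, ∫ θ in Set.Ioo (-Real.pi) Real.pi, ‖f (ρ * exp (θ * I))‖ ^ p = M ρ := by
    intro ρ
    have hper : Function.Periodic (fun θ : ℝ => ‖f (ρ * exp (θ * I))‖ ^ p) (2 * Real.pi) := by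
      intro θ
      have : exp (((θ + 2 * Real.pi : ℝ) : ℂ) * I) = exp (θ * I) := by
        push_cast
        rw [add_mul, exp_add, exp_two_pi_mul_I, mul_one]
      simp only [this]
    have h := hper.intervalIntegral_add_eq (-Real.pi) 0
    rw [zero_add, show -Real.pi + 2 * Real.pi = Real.pi by ring,
      intervalIntegral.integral_of_le (by linarith [Real.pi_pos]), integral_Ioc_eq_integral_Ioo] at h
    exact h
  have hcont : ContinuousOn (fun x : ℝ × ℝ => (x.1 * Real.log r - x.1 * Real.log x.1) *
      ‖f (x.1 * exp (x.2 * I))‖ ^ p) (Set.Icc 0 r ×ˢ Set.Icc (-Real.pi) Real.pi) := by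
    refine ContinuousOn.mul ?_ (ContinuousOn.rpow_const (ContinuousOn.norm
      (hf.continuousOn.comp (by fun_prop) fun x hx => ?_)) fun _ _ => Or.inr (by linarith))
    · exact ((continuous_fst.mul continuous_const).sub
        (Real.continuous_mul_log.comp continuous_fst)).continuousOn
    · rw [mem_ball_zero_iff, norm_mul, norm_exp_ofReal_mul_I, mul_one, norm_real,
        Real.norm_of_nonneg hx.1.1]
      exact hx.1.2.trans_lt hr.2
  have hint := (hcont.integrableOn_compact (μ := volume) (isCompact_Icc.prod isCompact_Icc)).mono_set
    (Set.prod_mono Set.Ioo_subset_Icc_self Set.Ioo_subset_Icc_self :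
      Set.Ioo 0 r ×ˢ Set.Ioo (-Real.pi) Real.pi ⊆ _)
  have hlog : ∀ ρ ∈ Set.Ioo 0 r, ρ * Real.log r - ρ * Real.log ρ = ρ * Real.log (r / ρ) := by
    intro ρ hρ
    rw [Real.log_div hr.1.ne' hρ.1.ne', mul_sub]
  have hpolar : ∫ z in ball (0:ℂ) r, ‖f z‖ ^ p * Real.log (r / ‖z‖) =
      ∫ ρ in Set.Ioo 0 r, (ρ * Real.log r - ρ * Real.log ρ) * M ρ := by
    rw [setIntegral_ball_eq_polar]
    trans ∫ x in Set.Ioo 0 r ×ˢ Set.Ioo (-Real.pi) Real.pi,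
      (x.1 * Real.log r - x.1 * Real.log x.1) * ‖f (x.1 * exp (x.2 * I))‖ ^ p
    · refine setIntegral_congr_fun (measurableSet_Ioo.prod measurableSet_Ioo) fun x hx => ?_
      simp only [hlog x.1 hx.1, norm_mul, norm_exp_ofReal_mul_I, mul_one, norm_real,
        Real.norm_of_nonneg hx.1.1.le]
      ring
    · rw [Measure.volume_eq_prod] at hint ⊢
      rw [setIntegral_prod _ hint]
      simp only [integral_const_mul, hM']
  have hint' : IntegrableOn (fun ρ => (ρ * Real.log r - ρ * Real.log ρ) * M ρ)
      (Set.Ioo 0 r) := by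
    rw [Measure.volume_eq_prod, IntegrableOn, ← Measure.prod_restrict] at hint
    simpa only [IntegrableOn, integral_const_mul, hM'] using hint.integral_prod_left
  have hw : Continuous fun ρ : ℝ => ρ * Real.log r - ρ * Real.log ρ :=
    (continuous_id.mul continuous_const).sub Real.continuous_mul_log
  have hle : ∫ z in ball (0:ℂ) r, ‖f z‖ ^ p * Real.log (r / ‖z‖) ≤ r ^ 2 / 4 * M r := by
    rw [hpolar, ← integral_mul_log_div hr.1, intervalIntegral.integral_of_le hr.1.le,
      integral_Ioc_eq_integral_Ioo, ← setIntegral_congr_fun measurableSet_Ioo hlog,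
      ← integral_mul_const]
    refine setIntegral_mono_on hint' ?_ measurableSet_Ioo fun ρ hρ => ?_
    · exact ((hw.mul continuous_const).integrableOn_Icc).mono_set Set.Ioo_subset_Icc_self
    · refine mul_le_mul_of_nonneg_left (hmono ⟨hρ.1.le, hρ.2.trans hr.2⟩ ⟨hr.1.le, hr.2⟩ hρ.2.le) ?_
      rw [hlog ρ hρ]
      exact mul_nonneg hρ.1.le (Real.log_nonneg ((one_le_div hρ.1).2 hρ.2.le))
  calc _ ≤ 1 / Real.pi * (r ^ 2 / 4 * M r) := by gcongr
    _ = _ := by ring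
end

section
/- Let 1 ≤ α < 2, ω a majorant with ω(t) > 0 for t > 0, and f ∈ C¹(𝔻) with ‖D_f(z)‖ ≤ C/ω((1-|z|)^α) for all z ∈ 𝔻 and some constant C > 0. Then there is a constant C₂ > 0 (one may take C₂ = 2C/(2-α)) such that for all z ∈ 𝔻 and r ∈ (0, 1-|z|]: (1/|𝔻(z,r)|) ∫_{𝔻(z,r)} |f(z) − f(ζ)| dA(ζ) ≤ C₂ · r / ω(r^α). -/
open Complex Metric MeasureTheory

/-- Wirtinger derivative f_z = (f_x - i f_y)/2. -/
noncomputable def wd (f : ℂ → ℂ) (z : ℂ) : ℂ :=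
  (fderiv ℝ f z 1 - Complex.I * fderiv ℝ f z Complex.I) / 2

/-- Wirtinger derivative f_z̄ = (f_x + i f_y)/2. -/
noncomputable def wdb (f : ℂ → ℂ) (z : ℂ) : ℂ :=
  (fderiv ℝ f z 1 + Complex.I * fderiv ℝ f z Complex.I) / 2

/-- ‖D_f(z)‖ = |f_z(z)| + |f_z̄(z)|. -/
noncomputable def Dnorm (f : ℂ → ℂ) (z : ℂ) : ℝ := ‖wd f z‖ + ‖wdb f z‖

theorem fderiv_apply_eq_wirtinger (f : ℂ → ℂ) (z v : ℂ) :
    fderiv ℝ f z v = wd f z * v + wdb f z * starRingEnd ℂ v := by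
  have hv : v = v.re • (1 : ℂ) + v.im • Complex.I := by
    simp [Complex.re_add_im]
  have hc : starRingEnd ℂ v = v.re - v.im * Complex.I := by
    apply Complex.ext <;> simp
  have hv' : v = v.re + v.im * Complex.I := (Complex.re_add_im v).symm
  have hL : fderiv ℝ f z v =
      v.re * fderiv ℝ f z 1 + v.im * fderiv ℝ f z Complex.I := by
    conv_lhs => rw [hv]
    rw [map_add, map_smul, map_smul, Complex.real_smul, Complex.real_smul]
  rw [hL, hc]
  conv_rhs => enter [1, 2]; rw [hv']
  unfold wd wdb
  linear_combination ((v.im : ℂ) * fderiv ℝ f z Complex.I) * Complex.I_mul_I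

theorem norm_fderiv_apply_le_Dnorm (f : ℂ → ℂ) (z v : ℂ) :
    ‖fderiv ℝ f z v‖ ≤ Dnorm f z * ‖v‖ := by
  rw [fderiv_apply_eq_wirtinger]
  refine (norm_add_le _ _).trans_eq ?_
  rw [norm_mul, norm_mul, RCLike.norm_conj, Dnorm, add_mul]

/-- Since `t / ω t` is non-decreasing and `α ≤ β`, the function `u ^ β / ω (u ^ α)` is
non-decreasing. -/
theorem one_div_majorant_rpow_le {ω : ℝ → ℝ} {α β u r : ℝ} (hα : 0 ≤ α) (hαβ : α ≤ β)
    (hpos : ∀ t : ℝ, 0 < t → 0 < ω t)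
    (hdec : ∀ u t : ℝ, 0 < u → u ≤ t → ω t / t ≤ ω u / u) (hu : 0 < u) (hur : u ≤ r) :
    1 / ω (u ^ α) ≤ r ^ β / ω (r ^ α) * u ^ (-β) := by
  have hr : 0 < r := hu.trans_le hur
  have hua : 0 < u ^ α := Real.rpow_pos_of_pos hu α
  have hra : 0 < r ^ α := Real.rpow_pos_of_pos hr α
  have hub : 0 < u ^ β := Real.rpow_pos_of_pos hu β
  have hωu := hpos _ hua
  have hωr := hpos _ hra
  have h1 := hdec _ _ hua (Real.rpow_le_rpow hu.le hur hα)
  rw [div_le_div_iff₀ hra hua] at h1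
  have h2 : u ^ (β - α) ≤ r ^ (β - α) := Real.rpow_le_rpow hu.le hur (by linarith)
  have hr2 : 0 < r ^ (β - α) := Real.rpow_pos_of_pos hr _
  have e1 : u ^ β = u ^ α * u ^ (β - α) := by rw [← Real.rpow_add hu]; ring_nf
  have e2 : r ^ β = r ^ α * r ^ (β - α) := by rw [← Real.rpow_add hr]; ring_nf
  rw [Real.rpow_neg hu.le, ← div_eq_mul_inv, div_div, div_le_div_iff₀ hωu (by positivity)]
  calc 1 * (ω (r ^ α) * u ^ β) = (ω (r ^ α) * u ^ α) * u ^ (β - α) := by rw [e1]; ring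
    _ ≤ (ω (u ^ α) * r ^ α) * r ^ (β - α) := by gcongr
    _ = r ^ β * ω (u ^ α) := by rw [e2]; ring

/-- If the differential of `f` is bounded by `K * (r - ‖w - z‖) ^ (-β)` on the disk of center `z`
and radius `r`, where `β > 1`, then integrating along radii bounds `f` itself. -/
theorem norm_sub_le_of_norm_fderiv_le {f : ℂ → ℂ} {z : ℂ} {r K β : ℝ} (hβ : 1 < β) (hK : 0 ≤ K)
    (hf : ∀ w ∈ ball z r, DifferentiableAt ℝ f w)
    (hbd : ∀ w ∈ ball z r, ∀ v, ‖fderiv ℝ f w v‖ ≤ K * (r - ‖w - z‖) ^ (-β) * ‖v‖)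
    {ζ : ℂ} (hζ : ζ ∈ ball z r) :
    ‖f z - f ζ‖ ≤ K / (β - 1) * (r - ‖ζ - z‖) ^ (1 - β) := by
  set v := ζ - z with hv
  have hvr : ‖v‖ < r := by simpa [dist_eq_norm] using hζ
  have hw : ∀ s ∈ Set.Icc (0 : ℝ) 1, ‖(z + s • v) - z‖ = s * ‖v‖ := by
    intro s hs
    rw [add_sub_cancel_left, norm_smul, Real.norm_of_nonneg hs.1]
  have hsv : ∀ s ∈ Set.Icc (0 : ℝ) 1, 0 < r - s * ‖v‖ := by
    intro s hs
    nlinarith [norm_nonneg v, hs.2]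
  have hmem : ∀ s ∈ Set.Icc (0 : ℝ) 1, z + s • v ∈ ball z r := by
    intro s hs
    rw [mem_ball, dist_eq_norm, hw s hs]
    linarith [hsv s hs]
  have hg : ∀ s ∈ Set.Icc (0 : ℝ) 1,
      HasDerivAt (fun s : ℝ => f (z + s • v) - f z) (fderiv ℝ f (z + s • v) v) s := by
    intro s hs
    have h1 : HasDerivAt (fun s : ℝ => z + s • v) v s := by
      simpa using ((hasDerivAt_id s).smul_const v).const_add z
    exact ((hf _ (hmem s hs)).hasFDerivAt.comp_hasDerivAt s h1).sub_const (f z)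
  have hB : ∀ s ∈ Set.Icc (0 : ℝ) 1,
      HasDerivAt (fun s : ℝ => K / (β - 1) * (r - s * ‖v‖) ^ (1 - β))
        (K * (r - s * ‖v‖) ^ (-β) * ‖v‖) s := by
    intro s hs
    have h1 : HasDerivAt (fun s : ℝ => r - s * ‖v‖) (-‖v‖) s := by
      simpa using ((hasDerivAt_id s).mul_const ‖v‖).const_sub r
    refine ((h1.rpow_const (p := 1 - β) (Or.inl (hsv s hs).ne')).const_mul
      (K / (β - 1))).congr_deriv ?_
    have : β - 1 ≠ 0 := by linarith
    rw [show 1 - β - 1 = -β by ring]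
    field_simp
    ring
  have key := image_norm_le_of_norm_deriv_right_le_deriv_boundary' (a := (0 : ℝ)) (b := 1)
    (fun s hs => (hg s hs).continuousAt.continuousWithinAt)
    (fun s hs => (hg s (Set.Ico_subset_Icc_self hs)).hasDerivWithinAt)
    (B := fun s : ℝ => K / (β - 1) * (r - s * ‖v‖) ^ (1 - β))
    (by
      have hr : 0 < r := (norm_nonneg v).trans_lt hvr
      have : 0 < β - 1 := by linarith
      simp only [zero_smul, add_zero, sub_self, norm_zero]
      have := hsv 0 (by simp)
      positivity)
    (fun s hs => (hB s hs).continuousAt.continuousWithinAt)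
    (fun s hs => (hB s (Set.Ico_subset_Icc_self hs)).hasDerivWithinAt)
    (fun s hs => by
      have hs' := Set.Ico_subset_Icc_self hs
      simpa only [hw s hs'] using hbd _ (hmem s hs') v)
    (Set.right_mem_Icc.2 zero_le_one)
  simpa [hv, norm_sub_rev] using key

theorem integrableOn_sub_rpow {r p : ℝ} (hr : 0 ≤ r) (hp : -1 < p) :
    IntegrableOn (fun t : ℝ => (r - t) ^ p) (Set.Ioo 0 r) := by
  have h := (intervalIntegral.intervalIntegrable_rpow' (a := 0) (b := r) hp).comp_sub_left r
  rw [sub_zero, sub_self] at h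
  exact ((intervalIntegrable_iff_integrableOn_Ioo_of_le hr).1 h.symm)

theorem integral_sub_rpow {r p : ℝ} (hr : 0 ≤ r) (hp : -1 < p) :
    ∫ t in Set.Ioo 0 r, (r - t) ^ p = r ^ (p + 1) / (p + 1) := by
  rw [← integral_Ioc_eq_integral_Ioo, ← intervalIntegral.integral_of_le hr,
    intervalIntegral.integral_comp_sub_left (fun t : ℝ => t ^ p), sub_self, sub_zero,
    integral_rpow (Or.inl hp), Real.zero_rpow (by linarith), sub_zero]

theorem indicator_ball_sub_norm_rpow (z : ℂ) (r p : ℝ) :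
    (ball z r).indicator (fun ζ => (r - ‖ζ - z‖) ^ p) =
      fun ζ => (Set.Iio r).indicator (fun t => (r - t) ^ p) ‖ζ - z‖ := by
  ext ζ
  simp [Set.indicator, dist_eq_norm]

theorem smul_indicator_Iio_eq (r p : ℝ) :
    Set.EqOn
      (fun t : ℝ => t ^ (Module.finrank ℝ ℂ - 1) • (Set.Iio r).indicator (fun t => (r - t) ^ p) t)
      ((Set.Ioo 0 r).indicator fun t : ℝ => t * (r - t) ^ p) (Set.Ioi 0) := by
  intro t ht
  have ht' : 0 < t := ht
  simp [Set.indicator, ht', Complex.finrank_real_complex]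

theorem integrableOn_mul_sub_rpow {r p : ℝ} (hr : 0 ≤ r) (hp : -1 < p) :
    IntegrableOn (fun t : ℝ => t * (r - t) ^ p) (Set.Ioo 0 r) := by
  refine (integrableOn_sub_rpow hr hp).bdd_mul (c := r) measurable_id.aestronglyMeasurable ?_
  filter_upwards [ae_restrict_mem measurableSet_Ioo] with t ht
  exact (Real.norm_of_nonneg ht.1.le).trans_le ht.2.le

theorem integrableOn_ball_sub_norm_rpow (z : ℂ) {r p : ℝ} (hr : 0 ≤ r) (hp : -1 < p) :
    IntegrableOn (fun ζ => (r - ‖ζ - z‖) ^ p) (ball z r) := by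
  rw [← integrable_indicator_iff measurableSet_ball, indicator_ball_sub_norm_rpow]
  refine Integrable.comp_sub_right
    (f := fun ζ : ℂ => (Set.Iio r).indicator (fun t => (r - t) ^ p) ‖ζ‖) ?_ z
  rw [integrable_fun_norm_addHaar, integrableOn_congr_fun (smul_indicator_Iio_eq r p)
    measurableSet_Ioi]
  exact ((integrable_indicator_iff measurableSet_Ioo).2
    (integrableOn_mul_sub_rpow hr hp)).integrableOn

theorem integral_ball_sub_norm_rpow_le (z : ℂ) {r p : ℝ} (hr : 0 ≤ r) (hp : -1 < p) :
    ∫ ζ in ball z r, (r - ‖ζ - z‖) ^ p ≤ 2 * Real.pi * (r * (r ^ (p + 1) / (p + 1))) := by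
  rw [← integral_indicator measurableSet_ball, indicator_ball_sub_norm_rpow,
    integral_sub_right_eq_self
      (fun ζ : ℂ => (Set.Iio r).indicator (fun t => (r - t) ^ p) ‖ζ‖) z,
    integral_fun_norm_addHaar, setIntegral_congr_fun measurableSet_Ioi (smul_indicator_Iio_eq r p),
    setIntegral_indicator measurableSet_Ioo,
    Set.inter_eq_right.2 Set.Ioo_subset_Ioi_self]
  have hvol : (volume : Measure ℂ).real (ball 0 1) = Real.pi := by
    simp [Measure.real, Complex.volume_ball]
  rw [hvol, Complex.finrank_real_complex, ← integral_sub_rpow hr hp, ← integral_const_mul]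
  simp only [nsmul_eq_mul, smul_eq_mul, Nat.cast_ofNat, mul_assoc]
  gcongr 2 * (Real.pi * ?_)
  refine setIntegral_mono_on (integrableOn_mul_sub_rpow hr hp)
    ((integrableOn_sub_rpow hr hp).const_mul r) measurableSet_Ioo fun t ht => ?_
  exact mul_le_mul_of_nonneg_right ht.2.le (Real.rpow_nonneg (by linarith [ht.2]) p)

/-- Let 1 ≤ α < 2, ω a majorant with ω > 0 on (0,∞), f ∈ C¹(𝔻)
with ‖D_f(z)‖ ≤ C/ω((1-|z|)^α).  Then there is C₂ > 0 such that for all z ∈ 𝔻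
and r ∈ (0, 1-|z|]:
(1/|𝔻(z,r)|)∫_{𝔻(z,r)}|f(z)-f(ζ)| dA(ζ) ≤ C₂ r/ω(r^α). -/
theorem bloch_implies_mean_oscillation (α : ℝ) (hα1 : 1 ≤ α) (hα2 : α < 2)
    (ω : ℝ → ℝ)
    (hcont : ContinuousOn ω (Set.Ici 0))
    (hmono : MonotoneOn ω (Set.Ici 0))
    (h0 : ω 0 = 0)
    (hpos : ∀ t : ℝ, 0 < t → 0 < ω t)
    (hdec : ∀ u t : ℝ, 0 < u → u ≤ t → ω t / t ≤ ω u / u)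
    (f : ℂ → ℂ) (hf : ContDiffOn ℝ 1 f (ball (0:ℂ) 1))
    (C : ℝ) (hC : 0 < C)
    (hbd : ∀ z ∈ ball (0:ℂ) 1, Dnorm f z ≤ C / ω ((1 - ‖z‖) ^ α)) :
    ∃ C₂ : ℝ, 0 < C₂ ∧ ∀ z ∈ ball (0:ℂ) 1, ∀ r ∈ Set.Ioc (0:ℝ) (1 - ‖z‖),
      (1 / (Real.pi * r ^ 2)) * ∫ ζ in ball z r, ‖f z - f ζ‖ ≤
        C₂ * r / ω (r ^ α) := by
  set β := (2 + α) / 2 with hβ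
  have hβ1 : 1 < β := by linarith
  have hβ2 : β < 2 := by linarith
  have hβ1' : 0 < β - 1 := by linarith
  have hβ2' : 0 < 2 - β := by linarith
  refine ⟨2 * C / ((β - 1) * (2 - β)), by positivity, fun z _ r ⟨hr, hrz⟩ => ?_⟩
  have hωr : 0 < ω (r ^ α) := hpos _ (Real.rpow_pos_of_pos hr α)
  have hmem : ∀ w ∈ ball z r, 0 < r - ‖w - z‖ ∧ r - ‖w - z‖ ≤ 1 - ‖w‖ := by
    intro w hw
    rw [mem_ball, dist_eq_norm] at hw
    have := norm_add_le (w - z) z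
    rw [sub_add_cancel] at this
    constructor <;> linarith
  have hball : ∀ w ∈ ball z r, w ∈ ball (0 : ℂ) 1 := by
    intro w hw
    rw [mem_ball_zero_iff]
    linarith [hmem w hw]
  set K := C * (r ^ β / ω (r ^ α)) with hK
  have hK0 : 0 ≤ K := by positivity
  have hderiv : ∀ w ∈ ball z r, ∀ v,
      ‖fderiv ℝ f w v‖ ≤ K * (r - ‖w - z‖) ^ (-β) * ‖v‖ := by
    intro w hw v
    obtain ⟨hu, huw⟩ := hmem w hw
    refine (norm_fderiv_apply_le_Dnorm f w v).trans ?_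
    gcongr
    have hua : 0 < (r - ‖w - z‖) ^ α := Real.rpow_pos_of_pos hu α
    have hle : (r - ‖w - z‖) ^ α ≤ (1 - ‖w‖) ^ α := Real.rpow_le_rpow hu.le huw (by linarith)
    calc Dnorm f w ≤ C / ω ((1 - ‖w‖) ^ α) := hbd w (hball w hw)
      _ ≤ C / ω ((r - ‖w - z‖) ^ α) :=
        div_le_div_of_nonneg_left hC.le (hpos _ hua) (hmono hua.le (hua.le.trans hle) hle)
      _ = C * (1 / ω ((r - ‖w - z‖) ^ α)) := by ring
      _ ≤ C * (r ^ β / ω (r ^ α) * (r - ‖w - z‖) ^ (-β)) := by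
        gcongr
        exact one_div_majorant_rpow_le (by linarith) (by linarith) hpos hdec hu
          (by linarith [norm_nonneg (w - z)])
      _ = K * (r - ‖w - z‖) ^ (-β) := by rw [hK]; ring
  have hdiff : ∀ w ∈ ball z r, DifferentiableAt ℝ f w := fun w hw =>
    (hf.differentiableOn one_ne_zero).differentiableAt (isOpen_ball.mem_nhds (hball w hw))
  have hint : ∫ ζ in ball z r, ‖f z - f ζ‖ ≤
      K / (β - 1) * (2 * Real.pi * (r * (r ^ (2 - β) / (2 - β)))) := by
    calc ∫ ζ in ball z r, ‖f z - f ζ‖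
        ≤ ∫ ζ in ball z r, K / (β - 1) * (r - ‖ζ - z‖) ^ (1 - β) := by
          refine integral_mono_of_nonneg (Filter.Eventually.of_forall fun _ => norm_nonneg _)
            ((integrableOn_ball_sub_norm_rpow z hr.le (by linarith)).const_mul _) ?_
          filter_upwards [ae_restrict_mem measurableSet_ball] with ζ hζ
          exact norm_sub_le_of_norm_fderiv_le hβ1 hK0 hdiff hderiv hζ
      _ = K / (β - 1) * ∫ ζ in ball z r, (r - ‖ζ - z‖) ^ (1 - β) := integral_const_mul _ _
      _ ≤ _ := by
        have := integral_ball_sub_norm_rpow_le z hr.le (p := 1 - β) (by linarith)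
        rw [show 1 - β + 1 = 2 - β by ring] at this
        gcongr
  have hpow : r ^ β * r ^ (2 - β) = r ^ 2 := by
    rw [← Real.rpow_add hr, add_sub_cancel, Real.rpow_two]
  calc 1 / (Real.pi * r ^ 2) * ∫ ζ in ball z r, ‖f z - f ζ‖
      ≤ 1 / (Real.pi * r ^ 2) * (K / (β - 1) * (2 * Real.pi * (r * (r ^ (2 - β) / (2 - β))))) := by
        gcongr
    _ = 2 * C / ((β - 1) * (2 - β)) * r / ω (r ^ α) * (r ^ β * r ^ (2 - β) / r ^ 2) := by
        rw [hK]
        field_simp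
    _ = 2 * C / ((β - 1) * (2 - β)) * r / ω (r ^ α) := by
        rw [hpow, div_self (by positivity), mul_one]
end
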